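/- Let D and D' be •/◦/+-diagrams (stones colored black iff they are uncrossings) with the same associated pair of permutations, and suppose D' is obtained from D by exchanging a single elbow tile and a single crossing tile in the associated pipe dreams. If u_{b^in}^D ≥ u_{b^in}^{D'} in the Bruhat order for every box b, then D' was obtained from D by performing a corrective flip. -/

import Mathlib

namespace GoPaper

/-- Fillings of a box: black stone, white stone, or plus. -/
inductive Fill : Type
  | black | white | plus
deriving DecidableEq

/-- A Ferrers shape inside the `k × (n-k)` rectangle (rows indexed from the top by
`0,…,k-1`, columns from the left by `0,…,n-k-1`), given by its set of boxes,
which is closed to the northwest. -/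
structure Shape (n k : ℕ) where
  boxes : Finset (ℕ × ℕ)
  row_lt : ∀ b ∈ boxes, b.1 < k
  col_lt : ∀ b ∈ boxes, b.2 < n - k
  nw_closed : ∀ b ∈ boxes, ∀ r c : ℕ, r ≤ b.1 → c ≤ b.2 → (r, c) ∈ boxes

/-- A `•/◦/+`-diagram: a Ferrers shape together with a filling of its boxes. -/
structure Diagram (n k : ℕ) where
  S : Shape n k
  fill : ℕ × ℕ → Fill

/-- `inIn b c` means `c ∈ b^in`, i.e. `c` is weakly to the right of and weakly below `b`. -/
def inIn (b c : ℕ × ℕ) : Prop := b.1 ≤ c.1 ∧ b.2 ≤ c.2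

instance (b c : ℕ × ℕ) : Decidable (inIn b c) := by unfold inIn; infer_instance

/-- The simple transposition `s_i` (0-indexed), as a permutation of `ℕ`. -/
def sw (i : ℕ) : Equiv.Perm ℕ := Equiv.swap i (i + 1)

/-- The (0-indexed) index of the simple transposition labelling box `b`:
the top-left box `(0,0)` is labelled `n-k-1`, indices decrease to the right and
increase downward. -/
def lab (n k : ℕ) (b : ℕ × ℕ) : ℕ := n - k - 1 + b.1 - b.2

/-- The simple transposition labelling box `b`. -/
def sbox (n k : ℕ) (b : ℕ × ℕ) : Equiv.Perm ℕ := sw (lab n k b)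

/-- Coxeter length of a permutation of `S_n` (supported on `{0,…,n-1}`): the
number of inversions. -/
def len (n : ℕ) (π : Equiv.Perm ℕ) : ℕ :=
  ((Finset.range n ×ˢ Finset.range n).filter (fun p => p.1 < p.2 ∧ π p.2 < π p.1)).card

/-- A canonical reading order on the boxes of a shape: rows from bottom to top,
each row from right to left (a valid reading order; all notions read off in a
reading order are independent of its choice). -/
def readingList {n k : ℕ} (S : Shape n k) : List (ℕ × ℕ) :=
  (((List.range k).reverse).flatMap fun r =>
      ((List.range (n - k)).reverse).map fun c => (r, c)).filter
    (fun b => decide (b ∈ S.boxes))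

/-- Product, in the reading order, of the box transpositions over boxes satisfying `p`. -/
def readProd {n k : ℕ} (D : Diagram n k) (p : ℕ × ℕ → Bool) : Equiv.Perm ℕ :=
  (((readingList D.S).filter p).map fun b => sbox n k b).prod

/-- The permutation `u` of the pipe dream of `D`: product of labels of the stone boxes. -/
def permU {n k : ℕ} (D : Diagram n k) : Equiv.Perm ℕ :=
  readProd D (fun b => decide (D.fill b ≠ Fill.plus))

/-- The Grassmannian permutation `v = v_λ`: product of labels of all boxes. -/
def permV {n k : ℕ} (D : Diagram n k) : Equiv.Perm ℕ := readProd D (fun _ => true)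

/-- `u_{b^in}^D`: product of the labels of the stone boxes of `b^in` other than `b`. -/
def uIn {n k : ℕ} (D : Diagram n k) (b : ℕ × ℕ) : Equiv.Perm ℕ :=
  readProd D (fun c => decide (inIn b c ∧ c ≠ b ∧ D.fill c ≠ Fill.plus))

/-- `v_{b^in}`: product of the labels of all boxes of `b^in`. -/
def vIn {n k : ℕ} (D : Diagram n k) (b : ℕ × ℕ) : Equiv.Perm ℕ :=
  readProd D (fun c => decide (inIn b c))

/-- `u_b^D`: the label of `b` if `b` contains a stone, the identity if it contains a plus. -/
def uBox {n k : ℕ} (D : Diagram n k) (b : ℕ × ℕ) : Equiv.Perm ℕ :=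
  if D.fill b = Fill.plus then 1 else sbox n k b

/-- The length-drop condition `ℓ(u_{b^in} u_b s_b) < ℓ(u_{b^in} u_b)` at box `b`. -/
def lenDrop {n k : ℕ} (D : Diagram n k) (b : ℕ × ℕ) : Prop :=
  len n (uIn D b * uBox D b * sbox n k b) < len n (uIn D b * uBox D b)

/-- `b` violates the distinguished property: the length drops at `b`, but `b` is
not filled with a black stone. -/
def ViolatesDist {n k : ℕ} (D : Diagram n k) (b : ℕ × ℕ) : Prop :=
  b ∈ D.S.boxes ∧ D.fill b ≠ Fill.black ∧ lenDrop D b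

/-- `D` is a Go-diagram: a box contains a black stone iff the length drops there. -/
def IsGoDiagram {n k : ℕ} (D : Diagram n k) : Prop :=
  ∀ b ∈ D.S.boxes, (D.fill b = Fill.black ↔ lenDrop D b)

/-- Number of boxes of `D` with filling `f`. -/
def countFill {n k : ℕ} (D : Diagram n k) (f : Fill) : ℕ :=
  (D.S.boxes.filter (fun b => D.fill b = f)).card

/-- Length of row `r` of the shape. -/
def rowLen {n k : ℕ} (S : Shape n k) (r : ℕ) : ℕ :=
  ((Finset.range (n - k)).filter (fun c => (r, c) ∈ S.boxes)).card

/-- The (0-indexed) label of the vertical boundary step in row `r`. -/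
def vlab {n k : ℕ} (S : Shape n k) (r : ℕ) : ℕ := r + (n - k) - rowLen S r

/-- The (0-indexed) label of the horizontal boundary step in column `c`. -/
def hlab {n k : ℕ} (S : Shape n k) (c : ℕ) : ℕ :=
  (n - k - 1 - c) + ((Finset.range k).filter (fun r => c < rowLen S r)).card

/-- Labels of the pipes of the pipe dream of `D`: `pipeAux D fuel true b` is the
label of the pipe entering box `b` from the bottom, `pipeAux D fuel false b` the
label of the pipe entering from the right (stones are crossing tiles, pluses are
elbow tiles; pipes enter from the southeast boundary). -/
def pipeAux {n k : ℕ} (D : Diagram n k) : ℕ → Bool → ℕ × ℕ → ℕ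
  | 0, _, _ => 0
  | fuel + 1, true, b =>
      if (b.1 + 1, b.2) ∈ D.S.boxes then
        (if D.fill (b.1 + 1, b.2) = Fill.plus then pipeAux D fuel false (b.1 + 1, b.2)
          else pipeAux D fuel true (b.1 + 1, b.2))
      else hlab D.S b.2
  | fuel + 1, false, b =>
      if (b.1, b.2 + 1) ∈ D.S.boxes then
        (if D.fill (b.1, b.2 + 1) = Fill.plus then pipeAux D fuel true (b.1, b.2 + 1)
          else pipeAux D fuel false (b.1, b.2 + 1))
      else vlab D.S b.1

/-- The label of the pipe entering box `b` from the bottom. -/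
def pipeB {n k : ℕ} (D : Diagram n k) (b : ℕ × ℕ) : ℕ := pipeAux D (n + 1) true b

/-- The label of the pipe entering box `b` from the right. -/
def pipeR {n k : ℕ} (D : Diagram n k) (b : ℕ × ℕ) : ℕ := pipeAux D (n + 1) false b

/-- `b` is a box of `D` containing a stone (black or white). -/
def IsStone {n k : ℕ} (D : Diagram n k) (b : ℕ × ℕ) : Prop :=
  b ∈ D.S.boxes ∧ D.fill b ≠ Fill.plus

/-- The (unordered) pair of pipes passing through box `b`. -/
def pipePair {n k : ℕ} (D : Diagram n k) (b : ℕ × ℕ) : Finset ℕ :=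
  {pipeB D b, pipeR D b}

/-- `b, c` form a crossing/uncrossing pair: the same two pipes cross at `b`
(the pipe entering from the bottom is larger), flow northwest, and next
uncross at `c`. -/
def CrossUncrossPair {n k : ℕ} (D : Diagram n k) (b c : ℕ × ℕ) : Prop :=
  IsStone D b ∧ IsStone D c ∧ b ≠ c ∧
  pipeR D b < pipeB D b ∧ pipeB D c < pipeR D c ∧
  pipePair D b = pipePair D c ∧ inIn c b ∧
  ∀ d : ℕ × ℕ, IsStone D d → pipePair D d = pipePair D b →
    inIn c d → inIn d b → d = b ∨ d = c

/-- Stones of `D` are colored black iff they are uncrossing tiles. -/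
def BlackIffUncross {n k : ℕ} (D : Diagram n k) : Prop :=
  ∀ b ∈ D.S.boxes, (D.fill b = Fill.black ↔ (D.fill b ≠ Fill.plus ∧ pipeB D b < pipeR D b))

/-- Change the filling of box `b` to `f`. -/
def setFill {n k : ℕ} (D : Diagram n k) (b : ℕ × ℕ) (f : Fill) : Diagram n k :=
  ⟨D.S, fun c => if c = b then f else D.fill c⟩

/-- Recolor the stones of `D` so that a stone is black iff it is an uncrossing. -/
def recolor {n k : ℕ} (D : Diagram n k) : Diagram n k :=
  ⟨D.S, fun b => if D.fill b = Fill.plus then Fill.plus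
    else if pipeB D b < pipeR D b then Fill.black else Fill.white⟩

/-- Equality of diagrams: same shape and the same filling on every box of the shape. -/
def DEq {n k : ℕ} (D D' : Diagram n k) : Prop :=
  D.S = D'.S ∧ ∀ b ∈ D.S.boxes, D.fill b = D'.fill b

/-- The diagram obtained by switching the plus at `p` with the stone at `t`, then
recoloring stones black iff they are uncrossings. -/
def flipPlusWith {n k : ℕ} (D : Diagram n k) (p t : ℕ × ℕ) : Diagram n k :=
  recolor (setFill (setFill D p Fill.white) t Fill.plus)

/-- `(p, t)` is a legal corrective-flip pair for `D`: `p` is a plus violating the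
distinguished property, and `t` is either the white stone `w` with which it violates
the distinguished property (i.e. placing a crossing at `p` makes `(w, p)` a
crossing/uncrossing pair), or `w`'s uncrossing partner, if it exists. -/
def IsFlipPair {n k : ℕ} (D : Diagram n k) (p t : ℕ × ℕ) : Prop :=
  p ∈ D.S.boxes ∧ D.fill p = Fill.plus ∧ lenDrop D p ∧
  ∃ w : ℕ × ℕ, CrossUncrossPair (setFill D p Fill.white) w p ∧
    (t = w ∨ CrossUncrossPair D w t)

/-- `D'` is obtained from `D` by performing a corrective flip. -/
def IsCorrectiveFlip {n k : ℕ} (D D' : Diagram n k) : Prop :=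
  ∃ p t : ℕ × ℕ, IsFlipPair D p t ∧ DEq D' (flipPlusWith D p t)

/-- Product of the simple transpositions along a word. -/
def wordProd (w : List ℕ) : Equiv.Perm ℕ := (w.map sw).prod

/-- Bruhat order on `S_n`: `u ≤ v` iff some reduced word for `u` is a subword of
some reduced word for `v`. -/
def BruhatLE (n : ℕ) (u v : Equiv.Perm ℕ) : Prop :=
  ∃ wv : List ℕ, (∀ i ∈ wv, i + 1 < n) ∧ wordProd wv = v ∧ wv.length = len n v ∧
    ∃ wu : List ℕ, wu.Sublist wv ∧ wordProd wu = u ∧ wu.length = len n u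

/-- Componentwise order on finite subsets of `ℕ`. -/
def FinsetLE (S T : Finset ℕ) : Prop :=
  List.Forall₂ (· ≤ ·) (S.sort (· ≤ ·)) (T.sort (· ≤ ·))

/-- Strict componentwise order on finite subsets of `ℕ`. -/
def FinsetLT (S T : Finset ℕ) : Prop := FinsetLE S T ∧ S ≠ T

/-- The (0-indexed) top set `{n-k, …, n-1}` (the set `{n-k+1, …, n}` of the paper). -/
def topSet (n k : ℕ) : Finset ℕ := (Finset.range n).filter (fun i => n - k ≤ i)

/-- The set `I_b = u_{b^in} u_b (v_{b^in})⁻¹ v {n, n-1, …, n-k+1}`. -/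
def Iset {n k : ℕ} (D : Diagram n k) (b : ℕ × ℕ) : Finset ℕ :=
  (topSet n k).image (fun x => (uIn D b * uBox D b * (vIn D b)⁻¹ * permV D) x)

/-- The set `J_b = u_{b^in} (v_{b^in})⁻¹ v {n, n-1, …, n-k+1}`. -/
def Jset {n k : ℕ} (D : Diagram n k) (b : ℕ × ℕ) : Finset ℕ :=
  (topSet n k).image (fun x => (uIn D b * (vIn D b)⁻¹ * permV D) x)

/-- `I_λ`: the set of labels of the vertical boundary steps of the shape. -/
def Ilam {n k : ℕ} (S : Shape n k) : Finset ℕ := (Finset.range k).image (fun r => vlab S r)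

/-- The Plücker coordinate of a `k × n` matrix at a `k`-subset `I ⊆ {0,…,n-1}`. -/
noncomputable def plucker {n k : ℕ} (A : Matrix (Fin k) (Fin n) ℝ) (I : Finset ℕ) : ℝ :=
  Matrix.det (Matrix.of fun i j : Fin k =>
    if h : (I.sort (· ≤ ·)).getD (j : ℕ) 0 < n then A i ⟨(I.sort (· ≤ ·)).getD (j : ℕ) 0, h⟩
    else 0)

/-- Full-rank `k × n` real matrices: representatives of points of `Gr(k,n)`. -/
def GrRep (k n : ℕ) : Type := {A : Matrix (Fin k) (Fin n) ℝ // A.rank = k}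

instance (k n : ℕ) : TopologicalSpace (GrRep k n) := by unfold GrRep; infer_instance

/-- Row equivalence of full-rank matrices. -/
def grSetoid (k n : ℕ) : Setoid (GrRep k n) where
  r A B := ∃ g : Matrix (Fin k) (Fin k) ℝ, IsUnit g.det ∧ B.1 = g * A.1
  iseqv := by
    refine ⟨fun A => ⟨1, ?_, ?_⟩, ?_, ?_⟩
    · simp
    · simp
    · rintro A B ⟨g, hg, hB⟩
      refine ⟨g⁻¹, Matrix.isUnit_nonsing_inv_det g hg, ?_⟩
      rw [hB, ← Matrix.mul_assoc, Matrix.nonsing_inv_mul g hg, Matrix.one_mul]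
    · rintro A B C ⟨g, hg, hB⟩ ⟨h, hh, hC⟩
      exact ⟨h * g, by rw [Matrix.det_mul]; exact hh.mul hg,
        by rw [hC, hB, Matrix.mul_assoc]⟩

/-- The Grassmannian `Gr(k,n)`, as the quotient of full-rank `k × n` matrices by
row equivalence, with the quotient topology. -/
def Gr (k n : ℕ) : Type := Quotient (grSetoid k n)

instance (k n : ℕ) : TopologicalSpace (Gr k n) := by
  unfold Gr; exact instTopologicalSpaceQuotient

/-- Matrix representatives of the Deodhar component indexed by a Go-diagram `D`:
`Δ_{I_b} = 0` for white-stone boxes, `Δ_{I_b} ≠ 0` for plus boxes, `Δ_{I_λ} ≠ 0`,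
and `Δ_S = 0` whenever `S ≱ I_λ`. -/
def deodharRep {n k : ℕ} (D : Diagram n k) : Set (Matrix (Fin k) (Fin n) ℝ) :=
  {A | (∀ b ∈ D.S.boxes, D.fill b = Fill.white → plucker A (Iset D b) = 0) ∧
      (∀ b ∈ D.S.boxes, D.fill b = Fill.plus → plucker A (Iset D b) ≠ 0) ∧
      plucker A (Ilam D.S) ≠ 0 ∧
      (∀ S : Finset ℕ, S ⊆ Finset.range n → S.card = k →
        ¬ FinsetLE (Ilam D.S) S → plucker A S = 0)}

/-- The Deodhar component in `Gr(k,n)` indexed by a Go-diagram `D`. -/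
def deodhar {n k : ℕ} (D : Diagram n k) : Set (Gr k n) :=
  {x | ∃ A : GrRep k n, Quotient.mk (grSetoid k n) A = x ∧ A.1 ∈ deodharRep D}

/-- The dimension of the Deodhar component indexed by `D` (by Deodhar's theorem,
the component is homeomorphic to `ℝ^{#black} × (ℝ \ {0})^{#plus}`). -/
def dimD {n k : ℕ} (D : Diagram n k) : ℕ :=
  countFill D Fill.black + countFill D Fill.plus

/-- The positroid cell of shape `S` and permutation `u`: the union of the Deodhar
components indexed by Go-diagrams of shape `S` with pipe-dream permutation `u`. -/
def positroid {n k : ℕ} (S : Shape n k) (u : Equiv.Perm ℕ) : Set (Gr k n) :=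
  {x | ∃ D : Diagram n k, D.S = S ∧ IsGoDiagram D ∧ permU D = u ∧ x ∈ deodhar D}

/-- A Le-diagram: no black stones, and no white stone with a plus above it in its
column and a plus to its left in its row. -/
def IsLeDiagram {n k : ℕ} (D : Diagram n k) : Prop :=
  (∀ b ∈ D.S.boxes, D.fill b ≠ Fill.black) ∧
  ∀ b ∈ D.S.boxes, D.fill b = Fill.white →
    ¬((∃ r : ℕ, r < b.1 ∧ D.fill (r, b.2) = Fill.plus) ∧
      (∃ c : ℕ, c < b.2 ∧ D.fill (b.1, c) = Fill.plus))

/-- A Le-move: on a rectangle with pluses in the top-left, top-right and bottom-left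
corners, a white stone in the bottom-right corner, and white stones elsewhere,
exchange the top-left plus with the bottom-right white stone. -/
def IsLeMove {n k : ℕ} (D D' : Diagram n k) : Prop :=
  D'.S = D.S ∧
  ∃ r1 r2 c1 c2 : ℕ, r1 < r2 ∧ c1 < c2 ∧ (r2, c2) ∈ D.S.boxes ∧
    D.fill (r1, c1) = Fill.plus ∧ D.fill (r1, c2) = Fill.plus ∧
    D.fill (r2, c1) = Fill.plus ∧ D.fill (r2, c2) = Fill.white ∧
    (∀ r c : ℕ, r1 ≤ r → r ≤ r2 → c1 ≤ c → c ≤ c2 →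
      ¬((r = r1 ∨ r = r2) ∧ (c = c1 ∨ c = c2)) → D.fill (r, c) = Fill.white) ∧
    D'.fill (r1, c1) = Fill.white ∧ D'.fill (r2, c2) = Fill.plus ∧
    (∀ b : ℕ × ℕ, b ≠ (r1, c1) → b ≠ (r2, c2) → D'.fill b = D.fill b)

/-- The first black stone or plus strictly to the right of `b` in its row. -/
def firstRight {n k : ℕ} (D : Diagram n k) (b : ℕ × ℕ) : Option (ℕ × ℕ) :=
  ((List.range (n - k)).map fun t => (b.1, b.2 + 1 + t)).find?
    (fun x => decide (x ∈ D.S.boxes ∧ D.fill x ≠ Fill.white))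

/-- The first black stone or plus strictly below `b` in its column. -/
def firstDown {n k : ℕ} (D : Diagram n k) (b : ℕ × ℕ) : Option (ℕ × ℕ) :=
  ((List.range k).map fun t => (b.1 + 1 + t, b.2)).find?
    (fun x => decide (x ∈ D.S.boxes ∧ D.fill x ≠ Fill.white))

/-- `x` is (relative to the oracle `pf`) the partner of some black stone of `b^in`
other than `b`. -/
noncomputable def partneredWhite {n k : ℕ} (D : Diagram n k) (pf : ℕ × ℕ → Option (ℕ × ℕ))
    (b x : ℕ × ℕ) : Bool :=
  D.S.boxes.toList.any fun d =>
    decide (inIn b d ∧ d ≠ b ∧ D.fill d = Fill.black ∧ pf d = some x)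

/-- Step 5 of the partner algorithm: the path from `b` travelling right
(`dir = true`) or down (`dir = false`), given an oracle `pf` of previously
assigned partners; turns at pluses, jumps at black stones to their partners,
and turns at white stones partnered with black stones of `b^in`. -/
noncomputable def pathAux {n k : ℕ} (D : Diagram n k) (pf : ℕ × ℕ → Option (ℕ × ℕ)) (b : ℕ × ℕ) :
    ℕ → Bool → ℕ × ℕ → List (ℕ × ℕ)
  | 0, _, _ => []
  | fuel + 1, dir, x =>
      let x' : ℕ × ℕ := if dir then (x.1, x.2 + 1) else (x.1 + 1, x.2)
      if x' ∈ D.S.boxes then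
        match D.fill x' with
        | Fill.plus => x' :: pathAux D pf b fuel (!dir) x'
        | Fill.black =>
            match pf x' with
            | some q => x' :: q :: pathAux D pf b fuel (!dir) q
            | none => [x']
        | Fill.white =>
            if partneredWhite D pf b x' then x' :: pathAux D pf b fuel (!dir) x'
            else x' :: pathAux D pf b fuel dir x'
      else []

/-- One step of the partner algorithm at box `b`, given an oracle `pf` of
previously assigned partners. Returns (partner of `b`, path `P_b`, path `Q_b`). -/
noncomputable def partnerCore {n k : ℕ} (D : Diagram n k) (pf : ℕ × ℕ → Option (ℕ × ℕ)) (b : ℕ × ℕ) :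
    Option (ℕ × ℕ) × List (ℕ × ℕ) × List (ℕ × ℕ) :=
  match firstRight D b, firstDown D b with
  | some c, some d =>
      let e : ℕ × ℕ := (d.1, c.2)
      if e ∈ D.S.boxes ∧
          (¬ ∃ i ∈ Finset.range d.1, b.1 < i ∧ (i, c.2) ∈ D.S.boxes ∧
            D.fill (i, c.2) ≠ Fill.white) ∧
          (¬ ∃ j ∈ Finset.range c.2, b.2 < j ∧ (d.1, j) ∈ D.S.boxes ∧
            D.fill (d.1, j) ≠ Fill.white) then
        if D.fill e = Fill.white then
          (some e,
            b :: (((List.range (c.2 - b.2)).map fun t => (b.1, b.2 + 1 + t)) ++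
              ((List.range (d.1 - b.1)).map fun t => (b.1 + 1 + t, c.2))),
            b :: (((List.range (d.1 - b.1)).map fun t => (b.1 + 1 + t, b.2)) ++
              ((List.range (c.2 - b.2)).map fun t => (d.1, b.2 + 1 + t))))
        else
          let P := b :: pathAux D pf b (n + 1) true b
          let Q := b :: pathAux D pf b (n + 1) false b
          let common := P.filter (fun m => decide (m ∈ Q))
          match common.find? (fun m => common.all fun m' => decide (inIn m m')) with
          | some m => (if D.fill m = Fill.white then some m else none, P, Q)
          | none => (none, P, Q)
      else (none, [], [])
  | _, _ => (none, [], [])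

/-- Iterated partner assignment (the recursion bottoms out along the partial
order `≼`, whose chains have length at most `n`). -/
noncomputable def partnerAux {n k : ℕ} (D : Diagram n k) : ℕ → ℕ × ℕ → Option (ℕ × ℕ)
  | 0, _ => none
  | m + 1, b => (partnerCore D (partnerAux D m) b).1

/-- The partner of box `b` in `D` (if any), per the recursive partner algorithm. -/
noncomputable def partner {n k : ℕ} (D : Diagram n k) (b : ℕ × ℕ) : Option (ℕ × ℕ) :=
  partnerAux D (n + 2) b

/-- The path `P_b` of the partner algorithm. -/
noncomputable def pathP {n k : ℕ} (D : Diagram n k) (b : ℕ × ℕ) : List (ℕ × ℕ) :=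
  (partnerCore D (partnerAux D (n + 1)) b).2.1

/-- The path `Q_b` of the partner algorithm. -/
noncomputable def pathQ {n k : ℕ} (D : Diagram n k) (b : ℕ × ℕ) : List (ℕ × ℕ) :=
  (partnerCore D (partnerAux D (n + 1)) b).2.2

/-- `f(D,b)`: replace with pluses all black stones in boxes `c ≺ b` and all white
stones that are partners of such boxes. -/
noncomputable def fDb {n k : ℕ} (D : Diagram n k) (b : ℕ × ℕ) : Diagram n k :=
  ⟨D.S, fun x =>
    if (D.fill x = Fill.black ∧ inIn b x ∧ x ≠ b) ∨
        (∃ c ∈ D.S.boxes, inIn b c ∧ c ≠ b ∧ D.fill c = Fill.black ∧ partner D c = some x)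
    then Fill.plus else D.fill x⟩

/-- Replace all black stones of `D`, and all of their partners, with pluses. -/
noncomputable def reduceGo {n k : ℕ} (D : Diagram n k) : Diagram n k :=
  ⟨D.S, fun x =>
    if D.fill x = Fill.black ∨
        (∃ c ∈ D.S.boxes, D.fill c = Fill.black ∧ partner D c = some x)
    then Fill.plus else D.fill x⟩

/-- Product, in a reading order, of the labels of the stone boxes of `b^in`. -/
def stonesProd {n k : ℕ} (D : Diagram n k) (b : ℕ × ℕ) : Equiv.Perm ℕ :=
  readProd D (fun c => decide (inIn b c ∧ D.fill c ≠ Fill.plus))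

/-- Property (P1) at `b`: the product of the labels of the stone boxes of `b^in`
is the same in `f(D,b)` as in `D`. -/
def P1 {n k : ℕ} (D : Diagram n k) (b : ℕ × ℕ) : Prop :=
  stonesProd (fDb D b) b = stonesProd D b

/-- Property (P2) at `b`: `b` has partner `p` iff `p` and `b` form a
crossing/uncrossing pair in the pipe dream of `f(D,b)`. -/
def P2 {n k : ℕ} (D : Diagram n k) (b : ℕ × ℕ) : Prop :=
  ∀ p : ℕ × ℕ, (partner D b = some p ↔ CrossUncrossPair (fDb D b) p b)

/-- `D` is a (nonempty) full `rows × cols` rectangle. -/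
def IsRectangle {n k : ℕ} (D : Diagram n k) (rows cols : ℕ) : Prop :=
  0 < rows ∧ 0 < cols ∧ D.S.boxes = Finset.range rows ×ˢ Finset.range cols

/-- A minimal violation: a rectangular diagram in which the only box violating the
distinguished property is the top-left corner, and the pair of pipes that should
uncross there initially cross in the bottom-right corner. -/
def IsMinimalViolation {n k : ℕ} (D : Diagram n k) (rows cols : ℕ) : Prop :=
  IsRectangle D rows cols ∧
  ViolatesDist D (0, 0) ∧
  (∀ b ∈ D.S.boxes, ViolatesDist D b → b = (0, 0)) ∧
  pipePair D (0, 0) = pipePair D (rows - 1, cols - 1) ∧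
  D.fill (rows - 1, cols - 1) ≠ Fill.plus ∧
  pipeR D (rows - 1, cols - 1) < pipeB D (rows - 1, cols - 1)

/-- `a` strictly precedes `b` in the reading order of `readingList`. -/
def readBefore (a b : ℕ × ℕ) : Prop := b.1 < a.1 ∨ (a.1 = b.1 ∧ b.2 < a.2)

/-- Product of the labels of the boxes in `U` that occur in the list `l`. -/
noncomputable def listProd (n k : ℕ) (l : List (ℕ × ℕ)) (U : Set (ℕ × ℕ)) : Equiv.Perm ℕ :=
  open Classical in ((l.filter fun b => decide (b ∈ U)).map (sbox n k)).prod

/-- Product, in the reading order, of the labels of the boxes of `S` in `U`. -/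
noncomputable def boxProd {n k : ℕ} (S : Shape n k) (U : Set (ℕ × ℕ)) : Equiv.Perm ℕ :=
  listProd n k (readingList S) U

/-- Product of the labels of the boxes of `T` in `b^in` other than `b`. -/
noncomputable def entry {n k : ℕ} (S : Shape n k) (T : Set (ℕ × ℕ)) (b : ℕ × ℕ) :
    Equiv.Perm ℕ :=
  boxProd S {c | c ∈ T ∧ inIn b c ∧ c ≠ b}

/-- The pair of pipes entering `b` when the crossing tiles are the boxes of `T`. -/
noncomputable def entryPair {n k : ℕ} (S : Shape n k) (T : Set (ℕ × ℕ)) (b : ℕ × ℕ) :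
    Finset ℕ :=
  {entry S T b (lab n k b), entry S T b (lab n k b + 1)}

section ReadingOrder

variable {n k : ℕ} (S : Shape n k)

theorem mem_readingList (b : ℕ × ℕ) : b ∈ readingList S ↔ b ∈ S.boxes := by
  unfold readingList
  simp only [List.mem_filter, List.mem_flatMap, List.mem_reverse, List.mem_range, List.mem_map,
    decide_eq_true_eq, and_iff_right_iff_imp]
  intro h
  exact ⟨b.1, S.row_lt b h, b.2, S.col_lt b h, rfl⟩

theorem pairwise_readingList : (readingList S).Pairwise readBefore := by
  unfold readingList
  refine List.Pairwise.filter _ ?_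
  rw [List.pairwise_flatMap]
  refine ⟨fun r _ => ?_, ?_⟩
  · rw [List.pairwise_map, List.pairwise_reverse]
    exact List.pairwise_lt_range.imp fun h => Or.inr ⟨rfl, h⟩
  · rw [List.pairwise_reverse]
    refine List.pairwise_lt_range.imp fun h => ?_
    simp only [List.mem_map, List.mem_reverse, List.mem_range]
    rintro _ ⟨c, _, rfl⟩ _ ⟨c', _, rfl⟩
    exact Or.inl h

theorem readBefore_irrefl (a : ℕ × ℕ) : ¬ readBefore a a := by
  unfold readBefore; omega

theorem nodup_readingList : (readingList S).Nodup :=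
  (pairwise_readingList S).imp fun h hab => by
    subst hab
    exact readBefore_irrefl _ h

end ReadingOrder

section Products

variable {n k : ℕ}

theorem listProd_cons_of_mem {l : List (ℕ × ℕ)} {U : Set (ℕ × ℕ)} {a : ℕ × ℕ} (h : a ∈ U) :
    listProd n k (a :: l) U = sbox n k a * listProd n k l U := by
  simp [listProd, h]

theorem listProd_cons_of_notMem {l : List (ℕ × ℕ)} {U : Set (ℕ × ℕ)} {a : ℕ × ℕ} (h : a ∉ U) :
    listProd n k (a :: l) U = listProd n k l U := by
  simp [listProd, h]

theorem listProd_append (l m : List (ℕ × ℕ)) (U : Set (ℕ × ℕ)) :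
    listProd n k (l ++ m) U = listProd n k l U * listProd n k m U := by
  simp [listProd]

theorem listProd_congr {l : List (ℕ × ℕ)} {U V : Set (ℕ × ℕ)} (h : ∀ b ∈ l, b ∈ U ↔ b ∈ V) :
    listProd n k l U = listProd n k l V := by
  unfold listProd
  congr 2
  exact List.filter_congr fun b hb => decide_eq_decide.2 (h b hb)

theorem listProd_eq_one {l : List (ℕ × ℕ)} {U : Set (ℕ × ℕ)} (h : ∀ b ∈ l, b ∉ U) :
    listProd n k l U = 1 := by
  unfold listProd
  rw [List.filter_eq_nil_iff.2 (by simpa using h)]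
  simp

theorem commute_listProd {g : Equiv.Perm ℕ} {l : List (ℕ × ℕ)} {U : Set (ℕ × ℕ)}
    (h : ∀ b ∈ l, b ∈ U → Commute g (sbox n k b)) : Commute g (listProd n k l U) := by
  unfold listProd
  refine Commute.list_prod_right _ _ fun x hx => ?_
  simp only [List.mem_map, List.mem_filter, decide_eq_true_eq] at hx
  obtain ⟨b, ⟨hb, hU⟩, rfl⟩ := hx
  exact h b hb hU

theorem listProd_split {l : List (ℕ × ℕ)} {r : ℕ × ℕ → ℕ × ℕ → Prop} (hl : l.Pairwise r)
    (U V : Set (ℕ × ℕ))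
    (h : ∀ a ∈ l, ∀ b ∈ l, r a b → a ∈ U → a ∉ V → b ∈ U → b ∈ V →
      Commute (sbox n k a) (sbox n k b)) :
    listProd n k l U = listProd n k l (U ∩ V) * listProd n k l (U \ V) := by
  induction l with
  | nil => simp [listProd]
  | cons a l ih =>
    rw [List.pairwise_cons] at hl
    have ih' := ih hl.2 fun x hx y hy =>
      h x (List.mem_cons_of_mem _ hx) y (List.mem_cons_of_mem _ hy)
    by_cases hU : a ∈ U
    · by_cases hV : a ∈ V
      · rw [listProd_cons_of_mem hU, listProd_cons_of_mem (Set.mem_inter hU hV),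
          listProd_cons_of_notMem (fun h => h.2 hV), ih', mul_assoc]
      · rw [listProd_cons_of_mem hU, listProd_cons_of_notMem (fun h => hV h.2),
          listProd_cons_of_mem (Set.mem_sdiff_of_mem hU hV), ih', ← mul_assoc, ← mul_assoc]
        congr 1
        exact commute_listProd fun b hb hb' =>
          h a List.mem_cons_self b (List.mem_cons_of_mem _ hb) (hl.1 b hb) hU hV hb'.1 hb'.2
    · rw [listProd_cons_of_notMem hU, listProd_cons_of_notMem (fun h => hU h.1),
        listProd_cons_of_notMem (fun h => hU h.1), ih']

theorem listProd_apply_of_lab_ne {l : List (ℕ × ℕ)} {U : Set (ℕ × ℕ)} {x : ℕ}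
    (h : ∀ b ∈ l, b ∈ U → lab n k b ≠ x ∧ lab n k b + 1 ≠ x) : listProd n k l U x = x := by
  induction l with
  | nil => simp [listProd]
  | cons a l ih =>
    have ih' := ih fun b hb => h b (List.mem_cons_of_mem _ hb)
    by_cases hU : a ∈ U
    · have := h a List.mem_cons_self hU
      rw [listProd_cons_of_mem hU, Equiv.Perm.mul_apply, ih', sbox, sw,
        Equiv.swap_apply_of_ne_of_ne this.1.symm this.2.symm]
    · rw [listProd_cons_of_notMem hU, ih']

theorem sbox_commute {a b : ℕ × ℕ} (h : lab n k b + 1 < lab n k a) :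
    Commute (sbox n k a) (sbox n k b) := by
  apply Equiv.Perm.Disjoint.commute
  intro x
  unfold sbox sw
  by_cases hx : x = lab n k a ∨ x = lab n k a + 1
  · right; apply Equiv.swap_apply_of_ne_of_ne <;> omega
  · left; apply Equiv.swap_apply_of_ne_of_ne <;> omega

variable {S : Shape n k}

theorem lab_add_col {b : ℕ × ℕ} (hb : b ∈ S.boxes) :
    lab n k b + b.2 + 1 = n - k + b.1 := by
  have := S.col_lt b hb
  unfold lab; omega

theorem lab_lt {b : ℕ × ℕ} (hb : b ∈ S.boxes) : lab n k b + 1 < n := by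
  have := lab_add_col hb
  have := S.col_lt b hb
  have := S.row_lt b hb
  omega

theorem lab_far_of_incomparable {a b : ℕ × ℕ} (ha : a ∈ S.boxes) (hb : b ∈ S.boxes)
    (hab : ¬ inIn a b) (hba : ¬ inIn b a) :
    lab n k a + 1 < lab n k b ∨ lab n k b + 1 < lab n k a := by
  have := lab_add_col ha
  have := lab_add_col hb
  unfold inIn at hab hba
  omega

theorem boxProd_congr {U V : Set (ℕ × ℕ)} (h : ∀ b ∈ S.boxes, b ∈ U ↔ b ∈ V) :
    boxProd S U = boxProd S V :=
  listProd_congr fun b hb => h b ((mem_readingList S b).1 hb)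

theorem boxProd_apply_of_lab_ne {U : Set (ℕ × ℕ)} {x : ℕ}
    (h : ∀ b ∈ S.boxes, b ∈ U → lab n k b ≠ x ∧ lab n k b + 1 ≠ x) : boxProd S U x = x :=
  listProd_apply_of_lab_ne fun b hb => h b ((mem_readingList S b).1 hb)

theorem boxProd_split_inIn {b : ℕ × ℕ} (U : Set (ℕ × ℕ)) :
    boxProd S U = boxProd S (U ∩ {c | inIn b c}) * boxProd S (U \ {c | inIn b c}) := by
  refine listProd_split (pairwise_readingList S) _ _ fun x hx y hy hxy _ hx' _ hy' => ?_
  rw [mem_readingList] at hx hy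
  have := lab_add_col hx
  have := lab_add_col hy
  simp only [Set.mem_ofPred_eq, inIn] at hx' hy'
  unfold readBefore at hxy
  exact sbox_commute (by omega)

theorem boxProd_singleton {b : ℕ × ℕ} (hb : b ∈ S.boxes) : boxProd S {b} = sbox n k b := by
  obtain ⟨l, m, h⟩ := List.append_of_mem ((mem_readingList S b).2 hb)
  have hnd := nodup_readingList S
  unfold boxProd
  rw [h] at hnd ⊢
  rw [List.nodup_append, List.nodup_cons] at hnd
  rw [listProd_append, listProd_cons_of_mem (Set.mem_singleton b),
    listProd_eq_one (l := l) (U := {b}) (fun c hc hcb => hnd.2.2 c hc b List.mem_cons_self hcb),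
    listProd_eq_one (l := m) (U := {b}) (fun c hc hcb => hnd.2.1.1 (Set.mem_singleton_iff.1 hcb ▸ hc))]
  simp

theorem boxProd_eq_entry_mul {U T : Set (ℕ × ℕ)} {b : ℕ × ℕ}
    (hU : ∀ c ∈ S.boxes, inIn b c → c ≠ b → (c ∈ U ↔ c ∈ T)) (hb : b ∉ U) :
    boxProd S U = entry S T b * boxProd S (U \ {c | inIn b c}) := by
  rw [boxProd_split_inIn (b := b) U]
  congr 1
  refine boxProd_congr fun c hc => ?_
  simp only [Set.mem_inter_iff, Set.mem_ofPred_eq]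
  have := hU c hc
  by_cases hcb : c = b
  · subst hcb; tauto
  · tauto

theorem boxProd_eq_entry_mul_sbox_mul {U T : Set (ℕ × ℕ)} {b : ℕ × ℕ} (hbS : b ∈ S.boxes)
    (hU : ∀ c ∈ S.boxes, inIn b c → c ≠ b → (c ∈ U ↔ c ∈ T)) (hb : b ∈ U) :
    boxProd S U = entry S T b * sbox n k b * boxProd S (U \ {c | inIn b c}) := by
  rw [boxProd_split_inIn (b := b) U]
  congr 1
  unfold boxProd entry
  rw [listProd_split (pairwise_readingList S) (U ∩ {c | inIn b c}) {c | c ≠ b},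
    ← boxProd_singleton hbS]
  · congr 1
    · refine boxProd_congr fun c hc => ?_
      simp only [Set.mem_inter_iff, Set.mem_ofPred_eq]
      have := hU c hc
      tauto
    · refine boxProd_congr fun c _ => ?_
      simp only [Set.mem_inter_iff, Set.mem_sdiff, Set.mem_ofPred_eq, not_not,
        Set.mem_singleton_iff]
      constructor
      · tauto
      · rintro rfl
        exact ⟨⟨hb, le_rfl, le_rfl⟩, rfl⟩
  · intro x _ y _ hxy _ hx hy _
    simp only [Set.mem_ofPred_eq, not_not] at hx
    subst hx
    have := hy.2
    simp only [Set.mem_ofPred_eq, inIn] at this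
    unfold readBefore at hxy
    omega

/-- Toggling the crossing at `b` multiplies the product over an order ideal by the transposition
of the pipes entering `b`. -/
theorem boxProd_insert {U T : Set (ℕ × ℕ)} {b : ℕ × ℕ} (hbS : b ∈ S.boxes)
    (hU : ∀ c ∈ S.boxes, inIn b c → c ≠ b → (c ∈ U ↔ c ∈ T)) (hb : b ∉ U) :
    boxProd S (insert b U) =
      Equiv.swap (entry S T b (lab n k b)) (entry S T b (lab n k b + 1)) * boxProd S U := by
  rw [boxProd_eq_entry_mul hU hb, boxProd_eq_entry_mul_sbox_mul (T := T) hbS _ (by simp),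
    sbox, sw, Equiv.mul_swap_eq_swap_mul, mul_assoc]
  · congr 2
    refine boxProd_congr fun c _ => ?_
    simp only [Set.mem_sdiff, Set.mem_insert_iff, Set.mem_ofPred_eq]
    constructor
    · rintro ⟨rfl | h, h'⟩
      · exact absurd ⟨le_rfl, le_rfl⟩ h'
      · exact ⟨h, h'⟩
    · tauto
  · intro c hc hbc hcb
    simp [hcb, hU c hc hbc hcb]

theorem boxProd_apply_lab {U T : Set (ℕ × ℕ)} {b : ℕ × ℕ} (hbS : b ∈ S.boxes)
    (hU : ∀ c ∈ S.boxes, inIn b c → c ≠ b → (c ∈ U ↔ c ∈ T))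
    (hU' : ∀ c ∈ U, ¬ inIn c b) :
    boxProd S U (lab n k b) = entry S T b (lab n k b) ∧
      boxProd S U (lab n k b + 1) = entry S T b (lab n k b + 1) := by
  have hb : b ∉ U := fun h => hU' b h ⟨le_rfl, le_rfl⟩
  rw [boxProd_eq_entry_mul hU hb, Equiv.Perm.mul_apply, Equiv.Perm.mul_apply,
    boxProd_apply_of_lab_ne, boxProd_apply_of_lab_ne]
  · exact ⟨rfl, rfl⟩
  all_goals
    intro c hc hcU
    have := lab_far_of_incomparable hc hbS (hU' c hcU.1) hcU.2
    omega

end Products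

section Pipes

variable {n k : ℕ} {S : Shape n k} {T : Set (ℕ × ℕ)}

theorem entry_ne (T : Set (ℕ × ℕ)) (b : ℕ × ℕ) :
    entry S T b (lab n k b) ≠ entry S T b (lab n k b + 1) :=
  fun h => by simpa using (entry S T b).injective h

theorem entry_congr {T' : Set (ℕ × ℕ)} {b : ℕ × ℕ}
    (h : ∀ c ∈ S.boxes, inIn b c → c ≠ b → (c ∈ T ↔ c ∈ T')) : entry S T b = entry S T' b := by
  refine boxProd_congr fun c hc => ?_
  simp only [Set.mem_ofPred_eq]
  have := h c hc
  tauto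

theorem pair_eq_pair_iff {a b c d : ℕ} (hab : a ≠ b) :
    ({a, b} : Finset ℕ) = {c, d} ↔ (a = c ∧ b = d) ∨ (a = d ∧ b = c) := by
  constructor
  · intro h
    have h1 : a ∈ ({c, d} : Finset ℕ) := h ▸ by simp
    have h2 : b ∈ ({c, d} : Finset ℕ) := h ▸ by simp
    simp only [Finset.mem_insert, Finset.mem_singleton] at h1 h2
    omega
  · rintro (⟨rfl, rfl⟩ | ⟨rfl, rfl⟩)
    · rfl
    · exact Finset.pair_comm _ _

/-- Two pipes can only meet in boxes that are comparable. -/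
theorem comparable_of_entryPair_eq {d e : ℕ × ℕ} (hd : d ∈ S.boxes) (he : e ∈ S.boxes)
    (h : entryPair S T d = entryPair S T e) : inIn d e ∨ inIn e d := by
  by_contra! hinc
  have key : ∀ x y : ℕ × ℕ, x ∈ S.boxes → ¬ inIn x y → ¬ inIn y x →
      boxProd S {c | c ∈ T ∧ (inIn x c ∨ inIn y c) ∧ c ≠ x ∧ c ≠ y} (lab n k x) =
          entry S T x (lab n k x) ∧
        boxProd S {c | c ∈ T ∧ (inIn x c ∨ inIn y c) ∧ c ≠ x ∧ c ≠ y} (lab n k x + 1) =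
          entry S T x (lab n k x + 1) := by
    intro x y hx hxy hyx
    refine boxProd_apply_lab hx ?_ ?_
    · intro c _ hc hcx
      have : c ≠ y := by rintro rfl; exact hxy hc
      simp only [Set.mem_ofPred_eq]
      tauto
    · rintro c ⟨-, hc, hcx, -⟩ hcx'
      rcases hc with hc | hc
      · exact hcx (Prod.ext (le_antisymm hcx'.1 hc.1) (le_antisymm hcx'.2 hc.2))
      · exact hyx ⟨hc.1.trans hcx'.1, hc.2.trans hcx'.2⟩
  have h1 := key d e hd hinc.1 hinc.2
  have h2 := key e d he hinc.2 hinc.1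
  have hset : {c | c ∈ T ∧ (inIn e c ∨ inIn d c) ∧ c ≠ e ∧ c ≠ d} =
      {c | c ∈ T ∧ (inIn d c ∨ inIn e c) ∧ c ≠ d ∧ c ≠ e} := by
    ext c; simp only [Set.mem_ofPred_eq]; tauto
  rw [hset] at h2
  have hlab := lab_far_of_incomparable hd he hinc.1 hinc.2
  unfold entryPair at h
  rw [pair_eq_pair_iff (entry_ne T d), ← h1.1, ← h1.2, ← h2.1, ← h2.2] at h
  simp only [EmbeddingLike.apply_eq_iff_eq] at h
  omega

theorem listProd_prefix_apply_lab {l m : List (ℕ × ℕ)} {b : ℕ × ℕ}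
    (h : readingList S = l ++ b :: m) :
    listProd n k l T (lab n k b) = entry S T b (lab n k b) ∧
      listProd n k l T (lab n k b + 1) = entry S T b (lab n k b + 1) := by
  have hb : b ∈ S.boxes := by rw [← mem_readingList, h]; simp
  have hpw := pairwise_readingList S
  rw [h, List.pairwise_append, List.pairwise_cons] at hpw
  have hlm : ∀ c ∈ b :: m, c ∉ l := fun c hc hcl => readBefore_irrefl c (hpw.2.2 c hcl c hc)
  have hl : listProd n k l T = boxProd S {c | c ∈ T ∧ c ∈ l} := by
    unfold boxProd
    rw [h, listProd_append, listProd_eq_one (l := b :: m) fun c hc hcU => hlm c hc hcU.2, mul_one]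
    exact listProd_congr fun c hc => by simp [hc]
  rw [hl]
  refine boxProd_apply_lab hb ?_ ?_
  · intro c hc hbc hcb
    rw [← mem_readingList, h, List.mem_append, List.mem_cons] at hc
    have hcl : c ∈ l := by
      rcases hc with hc | hc | hc
      · exact hc
      · exact absurd hc hcb
      · have := hpw.2.1.1 c hc
        unfold readBefore at this
        unfold inIn at hbc
        omega
    simp [hcl]
  · rintro c ⟨-, hc⟩ hcb
    have := hpw.2.2 c hc b List.mem_cons_self
    unfold readBefore at this
    unfold inIn at hcb
    omega

theorem sw_lt_sw_iff {i x y : ℕ} (h : ¬ (x = i ∧ y = i + 1)) (h' : ¬ (x = i + 1 ∧ y = i)) :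
    sw i x < sw i y ↔ x < y := by
  unfold sw
  simp only [Equiv.swap_apply_def]
  split_ifs <;> omega

/-- The relative position of two pipes does not change along a stretch of the reading order
without crossings of the two pipes. -/
theorem listProd_symm_lt_iff {l m r : List (ℕ × ℕ)} {α β : ℕ}
    (h : readingList S = l ++ (m ++ r)) (hm : ∀ x ∈ m, x ∈ T → entryPair S T x ≠ {α, β}) :
    (listProd n k (l ++ m) T).symm α < (listProd n k (l ++ m) T).symm β ↔
      (listProd n k l T).symm α < (listProd n k l T).symm β := by
  induction m generalizing l with
  | nil => simp
  | cons x m ih =>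
    have ih' := ih (l := l ++ [x]) (by simp [h]) fun y hy => hm y (List.mem_cons_of_mem _ hy)
    simp only [List.append_assoc, List.cons_append, List.nil_append] at ih'
    rw [ih', listProd_append]
    by_cases hx : x ∈ T
    · rw [listProd_cons_of_mem hx]
      have hnil : listProd n k [] T = 1 := listProd_eq_one (by simp)
      obtain ⟨h1, h2⟩ := listProd_prefix_apply_lab (T := T) (l := l) (b := x) (m := m ++ r) h
      have hne := hm x List.mem_cons_self hx
      unfold entryPair at hne
      rw [Ne, pair_eq_pair_iff (entry_ne T x), ← h1, ← h2] at hne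
      have hsymm : ∀ y, (listProd n k l T * (sbox n k x * 1)).symm y =
          sw (lab n k x) ((listProd n k l T).symm y) := fun y => by
        rw [mul_one, ← Equiv.Perm.inv_def, mul_inv_rev, Equiv.Perm.mul_apply, sbox, sw,
          Equiv.swap_inv, Equiv.Perm.inv_def]
      rw [hnil, hsymm, hsymm]
      apply sw_lt_sw_iff
      · rintro ⟨ha, hb⟩
        rw [Equiv.symm_apply_eq] at ha hb
        exact hne (Or.inl ⟨ha.symm, hb.symm⟩)
      · rintro ⟨ha, hb⟩
        rw [Equiv.symm_apply_eq] at ha hb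
        exact hne (Or.inr ⟨hb.symm, ha.symm⟩)
    · rw [listProd_cons_of_notMem hx, listProd_eq_one (l := []) (by simp), mul_one]

/-- If two pipes do not cross before they meet at `e`, they enter `e` in their initial order. -/
theorem entry_lt_of_no_crossing {e : ℕ × ℕ} (he : e ∈ S.boxes)
    (h : ∀ x ∈ S.boxes, x ∈ T → entryPair S T x = entryPair S T e → inIn e x → x = e) :
    entry S T e (lab n k e) < entry S T e (lab n k e + 1) := by
  obtain ⟨l, m, hl⟩ := List.append_of_mem ((mem_readingList S e).2 he)
  have hpw := pairwise_readingList S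
  rw [hl, List.pairwise_append] at hpw
  have key := listProd_symm_lt_iff (T := T) (l := []) (m := l) (r := e :: m)
    (α := entry S T e (lab n k e)) (β := entry S T e (lab n k e + 1)) hl ?_
  · obtain ⟨h1, h2⟩ := listProd_prefix_apply_lab (T := T) hl
    rw [List.nil_append, listProd_eq_one (l := []) (by simp), ← h1, ← h2,
      Equiv.symm_apply_apply, Equiv.symm_apply_apply] at key
    rw [← h1, ← h2]
    exact key.1 (Nat.lt_succ_self _)
  · intro x hx hxT hpair
    have hxS : x ∈ S.boxes := by rw [← mem_readingList, hl]; simp [hx]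
    have hxe := hpw.2.2 x hx e List.mem_cons_self
    rcases comparable_of_entryPair_eq hxS he hpair with hc | hc
    · unfold inIn at hc
      unfold readBefore at hxe
      omega
    · obtain rfl := h x hxS hxT hpair hc
      exact readBefore_irrefl _ hxe

/-- If two pipes cross at `d` and do not cross again before they meet at `e`, they enter `d`
and `e` in opposite orders. -/
theorem entry_swap_of_consecutive {d e : ℕ × ℕ} (hd : d ∈ S.boxes) (he : e ∈ S.boxes)
    (hdT : d ∈ T) (hde : d ≠ e) (hin : inIn e d) (hpair : entryPair S T d = entryPair S T e)
    (h : ∀ x ∈ S.boxes, x ∈ T → entryPair S T x = entryPair S T d → inIn e x → inIn x d →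
      x = d ∨ x = e) :
    entry S T e (lab n k e) = entry S T d (lab n k d + 1) ∧
      entry S T e (lab n k e + 1) = entry S T d (lab n k d) := by
  obtain ⟨l, m, hl⟩ := List.append_of_mem ((mem_readingList S d).2 hd)
  have hem : e ∈ m := by
    have hpw := pairwise_readingList S
    rw [hl, List.pairwise_append, List.pairwise_cons] at hpw
    have heL := (mem_readingList S e).2 he
    rw [hl, List.mem_append, List.mem_cons] at heL
    rcases heL with heL | heL | heL
    · have := hpw.2.2 e heL d List.mem_cons_self
      unfold readBefore at this
      unfold inIn at hin
      omega
    · exact absurd heL.symm hde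
    · exact heL
  obtain ⟨m, r, rfl⟩ := List.append_of_mem hem
  have hpw := pairwise_readingList S
  rw [hl, List.pairwise_append, List.pairwise_cons, List.pairwise_append] at hpw
  have key := listProd_symm_lt_iff (S := S) (T := T) (l := l ++ [d]) (m := m) (r := e :: r)
    (α := entry S T d (lab n k d)) (β := entry S T d (lab n k d + 1)) (by simp [hl]) ?_
  · obtain ⟨h1, h2⟩ := listProd_prefix_apply_lab (T := T) hl
    obtain ⟨h3, h4⟩ := listProd_prefix_apply_lab (T := T) (S := S) (l := l ++ [d] ++ m) (b := e)
      (m := r) (by simp [hl])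
    have hZ : listProd n k (l ++ [d]) T = listProd n k l T * sbox n k d := by
      rw [listProd_append, listProd_cons_of_mem hdT, listProd_eq_one (l := []) (by simp), mul_one]
    have h5 : (listProd n k (l ++ [d]) T).symm (entry S T d (lab n k d)) = lab n k d + 1 := by
      rw [Equiv.symm_apply_eq, hZ, Equiv.Perm.mul_apply, sbox, sw, Equiv.swap_apply_right, h1]
    have h6 : (listProd n k (l ++ [d]) T).symm (entry S T d (lab n k d + 1)) = lab n k d := by
      rw [Equiv.symm_apply_eq, hZ, Equiv.Perm.mul_apply, sbox, sw, Equiv.swap_apply_left, h2]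
    rw [h5, h6] at key
    unfold entryPair at hpair
    rw [pair_eq_pair_iff (entry_ne T d)] at hpair
    rcases hpair with ⟨ha, hb⟩ | ⟨ha, hb⟩
    · rw [ha, hb, ← h3, ← h4, Equiv.symm_apply_apply, Equiv.symm_apply_apply] at key
      omega
    · exact ⟨hb.symm, ha.symm⟩
  · intro x hx hxT hxpair
    have hxS : x ∈ S.boxes := by rw [← mem_readingList, hl]; simp [hx]
    change entryPair S T x = entryPair S T d at hxpair
    have hdx := hpw.2.1.1 x (by simp [hx])
    have hxe := hpw.2.1.2.2.2 x hx e List.mem_cons_self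
    have c1 : inIn x d := by
      refine (comparable_of_entryPair_eq hxS hd hxpair).resolve_right fun hc => ?_
      unfold inIn at hc
      unfold readBefore at hdx
      omega
    have c2 : inIn e x := by
      refine (comparable_of_entryPair_eq he hxS (hxpair.trans hpair).symm).resolve_right
        fun hc => ?_
      unfold inIn at hc
      unfold readBefore at hxe
      omega
    rcases h x hxS hxT hxpair c2 c1 with rfl | rfl
    · exact readBefore_irrefl _ hdx
    · exact readBefore_irrefl _ hxe

end Pipes

section Diagrams

variable {n k : ℕ}

theorem rowLen_eq {S : Shape n k} {b : ℕ × ℕ} (hb : b ∈ S.boxes)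
    (h : (b.1, b.2 + 1) ∉ S.boxes) : rowLen S b.1 = b.2 + 1 := by
  have : (Finset.range (n - k)).filter (fun c => (b.1, c) ∈ S.boxes) = Finset.range (b.2 + 1) := by
    ext c
    simp only [Finset.mem_filter, Finset.mem_range]
    constructor
    · rintro ⟨_, hc⟩
      by_contra hlt
      exact h (S.nw_closed _ hc _ _ le_rfl (by simpa using hlt))
    · intro hc
      have hmem := S.nw_closed _ hb b.1 c le_rfl (by omega)
      exact ⟨S.col_lt _ hmem, hmem⟩
  rw [rowLen, this, Finset.card_range]

theorem lt_rowLen_iff {S : Shape n k} {r c : ℕ} : c < rowLen S r ↔ (r, c) ∈ S.boxes := by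
  constructor
  · intro h
    by_contra hc
    refine absurd h (not_lt.2 ?_)
    refine (Finset.card_le_card (t := Finset.range c) fun x hx => ?_).trans_eq
      (Finset.card_range c)
    rw [Finset.mem_range]
    by_contra hlt
    exact hc (S.nw_closed _ (Finset.mem_filter.1 hx).2 _ _ le_rfl (by simpa using hlt))
  · intro h
    refine Nat.lt_of_succ_le ((Finset.card_range (c + 1)).symm.trans_le
      (Finset.card_le_card fun x hx => ?_))
    have hmem := S.nw_closed _ h r x le_rfl (by rw [Finset.mem_range] at hx; simp only; omega)
    exact Finset.mem_filter.2 ⟨Finset.mem_range.2 (S.col_lt _ hmem), hmem⟩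

theorem vlab_eq {S : Shape n k} {b : ℕ × ℕ} (hb : b ∈ S.boxes)
    (h : (b.1, b.2 + 1) ∉ S.boxes) : vlab S b.1 = lab n k b := by
  have := lab_add_col hb
  rw [vlab, rowLen_eq hb h]
  omega

theorem hlab_eq {S : Shape n k} {b : ℕ × ℕ} (hb : b ∈ S.boxes)
    (h : (b.1 + 1, b.2) ∉ S.boxes) : hlab S b.2 = lab n k b + 1 := by
  have hcol : (Finset.range k).filter (fun r => b.2 < rowLen S r) = Finset.range (b.1 + 1) := by
    ext r
    simp only [Finset.mem_filter, Finset.mem_range, lt_rowLen_iff]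
    constructor
    · rintro ⟨_, hr⟩
      by_contra hlt
      exact h (S.nw_closed _ hr _ _ (by simpa using hlt) le_rfl)
    · intro hr
      have hmem := S.nw_closed _ hb r b.2 (by omega) le_rfl
      exact ⟨S.row_lt _ hmem, hmem⟩
  have := lab_add_col hb
  have := S.col_lt b hb
  rw [hlab, hcol, Finset.card_range]
  omega

/-- The boxes of a diagram that do not contain a plus. -/
def stones (D : Diagram n k) : Set (ℕ × ℕ) := {c | D.fill c ≠ Fill.plus}

theorem uIn_eq_entry (D : Diagram n k) (b : ℕ × ℕ) : uIn D b = entry D.S (stones D) b := by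
  unfold uIn readProd entry boxProd listProd
  congr 2
  refine List.filter_congr fun c _ => decide_eq_decide.2 ?_
  simp only [stones, Set.mem_ofPred_eq]
  tauto

theorem permU_eq_boxProd (D : Diagram n k) : permU D = boxProd D.S (stones D) := by
  unfold permU readProd boxProd listProd
  congr 2
  exact List.filter_congr fun c _ => decide_eq_decide.2 Iff.rfl

theorem entry_apply_bottom {S : Shape n k} (T : Set (ℕ × ℕ)) {b : ℕ × ℕ} (hb : b ∈ S.boxes)
    (h : (b.1 + 1, b.2) ∈ S.boxes) :
    entry S T b (lab n k b + 1) =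
      entry S T (b.1 + 1, b.2) (lab n k (b.1 + 1, b.2) +
        (open Classical in if (b.1 + 1, b.2) ∈ T then 1 else 0)) := by
  have hlab := lab_add_col hb
  have hlab' := lab_add_col h
  have hfix : boxProd S ({c | c ∈ T ∧ inIn b c ∧ c ≠ b} \ {c | inIn (b.1 + 1, b.2) c})
      (lab n k b + 1) = lab n k b + 1 := by
    refine boxProd_apply_of_lab_ne fun c hc hcU => ?_
    have := lab_add_col hc
    obtain ⟨⟨-, hbc, hcb⟩, hc'⟩ := hcU
    have hcb' : c.1 ≠ b.1 ∨ c.2 ≠ b.2 := by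
      by_contra! hh
      exact hcb (Prod.ext hh.1 hh.2)
    simp only [Set.mem_ofPred_eq, inIn] at hbc hc'
    omega
  have hU : ∀ c ∈ S.boxes, inIn (b.1 + 1, b.2) c → c ≠ (b.1 + 1, b.2) →
      (c ∈ {c | c ∈ T ∧ inIn b c ∧ c ≠ b} ↔ c ∈ T) := by
    intro c _ hc _
    have h1 : inIn b c := by unfold inIn at hc ⊢; simp only at hc; omega
    have h2 : c ≠ b := by rintro rfl; unfold inIn at hc; simp only at hc; omega
    simp [h1, h2]
  simp only at hlab'
  have heq : lab n k b + 1 = lab n k (b.1 + 1, b.2) := by omega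
  have hin : inIn b (b.1 + 1, b.2) := by unfold inIn; simp
  have hne : (b.1 + 1, b.2) ≠ b := fun hh => by simpa using congrArg Prod.fst hh
  split_ifs with hT
  · rw [entry, boxProd_eq_entry_mul_sbox_mul h hU ⟨hT, hin, hne⟩, Equiv.Perm.mul_apply, hfix,
      Equiv.Perm.mul_apply, heq, sbox, sw, Equiv.swap_apply_left]
  · rw [entry, boxProd_eq_entry_mul hU fun hh => hT hh.1, Equiv.Perm.mul_apply, hfix, heq,
      add_zero]

theorem entry_apply_right {S : Shape n k} (T : Set (ℕ × ℕ)) {b : ℕ × ℕ} (hb : b ∈ S.boxes)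
    (h : (b.1, b.2 + 1) ∈ S.boxes) :
    entry S T b (lab n k b) =
      entry S T (b.1, b.2 + 1) (lab n k (b.1, b.2 + 1) +
        (open Classical in if (b.1, b.2 + 1) ∈ T then 0 else 1)) := by
  have hlab := lab_add_col hb
  have hlab' := lab_add_col h
  have hfix : boxProd S ({c | c ∈ T ∧ inIn b c ∧ c ≠ b} \ {c | inIn (b.1, b.2 + 1) c})
      (lab n k b) = lab n k b := by
    refine boxProd_apply_of_lab_ne fun c hc hcU => ?_
    have := lab_add_col hc
    obtain ⟨⟨-, hbc, hcb⟩, hc'⟩ := hcU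
    have hcb' : c.1 ≠ b.1 ∨ c.2 ≠ b.2 := by
      by_contra! hh
      exact hcb (Prod.ext hh.1 hh.2)
    simp only [Set.mem_ofPred_eq, inIn] at hbc hc'
    omega
  have hU : ∀ c ∈ S.boxes, inIn (b.1, b.2 + 1) c → c ≠ (b.1, b.2 + 1) →
      (c ∈ {c | c ∈ T ∧ inIn b c ∧ c ≠ b} ↔ c ∈ T) := by
    intro c _ hc _
    have h1 : inIn b c := by unfold inIn at hc ⊢; simp only at hc; omega
    have h2 : c ≠ b := by rintro rfl; unfold inIn at hc; simp only at hc; omega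
    simp [h1, h2]
  simp only at hlab'
  have heq : lab n k b = lab n k (b.1, b.2 + 1) + 1 := by omega
  have hin : inIn b (b.1, b.2 + 1) := by unfold inIn; simp
  have hne : (b.1, b.2 + 1) ≠ b := fun hh => by simpa using congrArg Prod.snd hh
  split_ifs with hT
  · rw [entry, boxProd_eq_entry_mul_sbox_mul h hU ⟨hT, hin, hne⟩, Equiv.Perm.mul_apply, hfix,
      Equiv.Perm.mul_apply, heq, sbox, sw, Equiv.swap_apply_right, add_zero]
  · rw [entry, boxProd_eq_entry_mul hU fun hh => hT hh.1, Equiv.Perm.mul_apply, hfix, heq]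

theorem pipeAux_eq_entry (D : Diagram n k) (fuel : ℕ) {b : ℕ × ℕ} (hb : b ∈ D.S.boxes)
    (hf : k + (n - k) ≤ fuel + b.1 + b.2) :
    pipeAux D fuel true b = entry D.S (stones D) b (lab n k b + 1) ∧
      pipeAux D fuel false b = entry D.S (stones D) b (lab n k b) := by
  induction fuel generalizing b with
  | zero =>
    have := D.S.row_lt b hb
    have := D.S.col_lt b hb
    omega
  | succ fuel ih =>
    constructor
    · rw [pipeAux]
      split_ifs with h hplus
      · rw [entry_apply_bottom _ hb h, if_neg (by simpa [stones] using hplus), add_zero]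
        exact (ih h (by simp only; omega)).2
      · rw [entry_apply_bottom _ hb h, if_pos (by simpa [stones] using hplus)]
        exact (ih h (by simp only; omega)).1
      · rw [hlab_eq hb h]
        refine (boxProd_apply_of_lab_ne fun c hc hcU => ?_).symm
        obtain ⟨-, hbc, hcb⟩ := hcU
        have h1 := lab_add_col hc
        have h2 := lab_add_col hb
        have h3 : c.1 = b.1 := by
          by_contra hne
          exact h (D.S.nw_closed c hc _ _ (by unfold inIn at hbc; omega) hbc.2)
        have h5 : c.2 ≠ b.2 := fun hh => hcb (Prod.ext h3 hh)
        unfold inIn at hbc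
        omega
    · rw [pipeAux]
      split_ifs with h hplus
      · rw [entry_apply_right _ hb h, if_neg (by simpa [stones] using hplus)]
        exact (ih h (by simp only; omega)).1
      · rw [entry_apply_right _ hb h, if_pos (by simpa [stones] using hplus), add_zero]
        exact (ih h (by simp only; omega)).2
      · rw [vlab_eq hb h]
        refine (boxProd_apply_of_lab_ne fun c hc hcU => ?_).symm
        obtain ⟨-, hbc, hcb⟩ := hcU
        have h1 := lab_add_col hc
        have h2 := lab_add_col hb
        have h3 : c.2 = b.2 := by
          by_contra hne
          exact h (D.S.nw_closed c hc _ _ hbc.1 (by unfold inIn at hbc; omega))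
        have h5 : c.1 ≠ b.1 := fun hh => hcb (Prod.ext hh h3)
        unfold inIn at hbc
        omega

theorem le_of_mem_boxes {S : Shape n k} {b : ℕ × ℕ} (hb : b ∈ S.boxes) : k ≤ n := by
  have := S.col_lt b hb
  omega

theorem pipeB_eq_entry {D : Diagram n k} {b : ℕ × ℕ} (hb : b ∈ D.S.boxes) :
    pipeB D b = entry D.S (stones D) b (lab n k b + 1) :=
  (pipeAux_eq_entry D (n + 1) hb (by have := le_of_mem_boxes hb; omega)).1

theorem pipeR_eq_entry {D : Diagram n k} {b : ℕ × ℕ} (hb : b ∈ D.S.boxes) :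
    pipeR D b = entry D.S (stones D) b (lab n k b) :=
  (pipeAux_eq_entry D (n + 1) hb (by have := le_of_mem_boxes hb; omega)).2

theorem pipePair_eq_entryPair {D : Diagram n k} {b : ℕ × ℕ} (hb : b ∈ D.S.boxes) :
    pipePair D b = entryPair D.S (stones D) b := by
  rw [pipePair, entryPair, pipeB_eq_entry hb, pipeR_eq_entry hb, Finset.pair_comm]

theorem pipe_congr {D D' : Diagram n k} {b : ℕ × ℕ} (hb : b ∈ D.S.boxes) (hS : D.S = D'.S)
    (h : ∀ c ∈ D.S.boxes, inIn b c → c ≠ b → (D.fill c = Fill.plus ↔ D'.fill c = Fill.plus)) :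
    pipeB D b = pipeB D' b ∧ pipeR D b = pipeR D' b := by
  rw [pipeB_eq_entry hb, pipeR_eq_entry hb, pipeB_eq_entry (hS ▸ hb), pipeR_eq_entry (hS ▸ hb),
    ← hS, entry_congr (T := stones D) (T' := stones D') fun c hc hbc hcb =>
      not_congr (h c hc hbc hcb)]
  exact ⟨rfl, rfl⟩

theorem len_mul_sw_lt {π : Equiv.Perm ℕ} {i : ℕ} (hi : i + 1 < n) (h : π (i + 1) < π i) :
    len n (π * sw i) < len n π := by
  unfold len
  have hsub : ((Finset.range n ×ˢ Finset.range n).filter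
      (fun p => p.1 < p.2 ∧ (π * sw i) p.2 < (π * sw i) p.1)).image
        (fun p => (sw i p.1, sw i p.2)) ⊂
      (Finset.range n ×ˢ Finset.range n).filter (fun p => p.1 < p.2 ∧ π p.2 < π p.1) := by
    have hlt : ∀ x, x < n → sw i x < n := by
      intro x hx
      unfold sw
      rw [Equiv.swap_apply_def]
      split_ifs <;> omega
    rw [Finset.ssubset_iff_of_subset]
    · refine ⟨(i, i + 1), by simp [h]; omega, ?_⟩
      simp only [Finset.mem_image, Finset.mem_filter, Prod.mk.injEq, not_exists, not_and]
      rintro ⟨x, y⟩ ⟨_, hxy, _⟩ hx hy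
      unfold sw at hx hy
      rw [Equiv.swap_apply_eq_iff] at hx hy
      simp only [Equiv.swap_apply_left, Equiv.swap_apply_right] at hx hy
      omega
    · intro q hq
      obtain ⟨⟨x, y⟩, hxy, rfl⟩ := Finset.mem_image.1 hq
      obtain ⟨hmem, hxy, hinv⟩ := Finset.mem_filter.1 hxy
      simp only [Finset.mem_product, Finset.mem_range] at hmem hxy
      rw [Equiv.Perm.mul_apply, Equiv.Perm.mul_apply] at hinv
      obtain ⟨hx, hy⟩ := hmem
      simp only [Finset.mem_filter, Finset.mem_product, Finset.mem_range]
      refine ⟨⟨hlt x hx, hlt y hy⟩, ?_, hinv⟩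
      refine (sw_lt_sw_iff ?_ ?_).2 hxy
      · rintro ⟨rfl, rfl⟩
        rw [sw, Equiv.swap_apply_left, Equiv.swap_apply_right] at hinv
        omega
      · omega
  refine lt_of_eq_of_lt (Finset.card_image_of_injective _ fun a b hab => ?_).symm
    (Finset.card_lt_card hsub)
  simp only [Prod.mk.injEq, EmbeddingLike.apply_eq_iff_eq] at hab
  exact Prod.ext hab.1 hab.2

theorem BruhatLE.len_le {u v : Equiv.Perm ℕ} (h : BruhatLE n u v) : len n u ≤ len n v := by
  obtain ⟨wv, _, _, hv, wu, hsub, _, hu⟩ := h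
  rw [← hv, ← hu]
  exact hsub.length_le

theorem lenDrop_of_pipeB_lt {D : Diagram n k} {b : ℕ × ℕ} (hb : b ∈ D.S.boxes)
    (hplus : D.fill b = Fill.plus) (h : pipeB D b < pipeR D b) : lenDrop D b := by
  rw [pipeB_eq_entry hb, pipeR_eq_entry hb] at h
  rw [lenDrop, uBox, if_pos hplus, mul_one, uIn_eq_entry]
  exact len_mul_sw_lt (lab_lt hb) h

end Diagrams

section Exchange

variable {n k : ℕ} {S : Shape n k} {T : Set (ℕ × ℕ)}

theorem inIn_trans {a b c : ℕ × ℕ} (h : inIn a b) (h' : inIn b c) : inIn a c :=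
  ⟨h.1.trans h'.1, h.2.trans h'.2⟩

theorem inIn_antisymm {a b : ℕ × ℕ} (h : inIn a b) (h' : inIn b a) : a = b :=
  Prod.ext (le_antisymm h.1 h'.1) (le_antisymm h.2 h'.2)

/-- A nonempty set of boxes of `S` has an element with no other element to its northwest. -/
theorem exists_northwest_minimal {F : Set (ℕ × ℕ)} (hF : ∃ x ∈ S.boxes, x ∈ F) :
    ∃ x ∈ S.boxes, x ∈ F ∧ ∀ y ∈ S.boxes, y ∈ F → inIn y x → y = x := by
  classical
  obtain ⟨x₀, hx₀, hx₀F⟩ := hF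
  obtain ⟨x, hx, hmin⟩ := Finset.exists_min_image (S.boxes.filter (· ∈ F)) (fun c => c.1 + c.2)
    ⟨x₀, Finset.mem_filter.2 ⟨hx₀, hx₀F⟩⟩
  rw [Finset.mem_filter] at hx
  refine ⟨x, hx.1, hx.2, fun y hy hyF hyx => ?_⟩
  have := hmin y (Finset.mem_filter.2 ⟨hy, hyF⟩)
  unfold inIn at hyx
  exact Prod.ext (by omega) (by omega)

theorem apply_succ_lt_of_len_swap_mul_le {u : Equiv.Perm ℕ} {i α β : ℕ} (hi : i + 1 < n)
    (hpair : ({u i, u (i + 1)} : Finset ℕ) = {α, β}) (h : len n (Equiv.swap α β * u) ≤ len n u) :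
    u (i + 1) < u i := by
  have hne : u i ≠ u (i + 1) := fun hh => by simpa using u.injective hh
  have hswap : Equiv.swap α β * u = u * sw i := by
    rw [sw, Equiv.mul_swap_eq_swap_mul]
    rcases (pair_eq_pair_iff hne).1 hpair with ⟨h1, h2⟩ | ⟨h1, h2⟩
    · rw [h1, h2]
    · rw [h1, h2, Equiv.swap_comm]
  by_contra hlt
  have := len_mul_sw_lt (π := u * sw i) hi (by
    simp only [Equiv.Perm.mul_apply, sw, Equiv.swap_apply_left, Equiv.swap_apply_right]
    omega)
  rw [mul_assoc, sw, Equiv.swap_mul_self, mul_one, ← sw, ← hswap] at this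
  omega

theorem entry_insert {E : Set (ℕ × ℕ)} {b t : ℕ × ℕ} (ht : t ∈ S.boxes) (htE : t ∉ E)
    (hbt : inIn b t) (hne : t ≠ b) :
    entry S (insert t E) b =
      Equiv.swap (entry S E t (lab n k t)) (entry S E t (lab n k t + 1)) * entry S E b := by
  have hset : {c | c ∈ insert t E ∧ inIn b c ∧ c ≠ b} =
      insert t {c | c ∈ E ∧ inIn b c ∧ c ≠ b} := by
    ext c
    simp only [Set.mem_ofPred_eq, Set.mem_insert_iff]
    constructor
    · tauto
    · rintro (rfl | h)
      · exact ⟨Or.inl rfl, hbt, hne⟩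
      · tauto
  unfold entry
  rw [hset]
  refine boxProd_insert ht (fun c _ htc hct => ?_) fun h => htE h.1
  have hcb : c ≠ b := by
    rintro rfl
    exact hct (inIn_antisymm hbt htc)
  simp [inIn_trans hbt htc, hcb]

theorem entry_insert_of_not {E : Set (ℕ × ℕ)} {b t : ℕ × ℕ} (h : inIn b t → t = b) :
    entry S (insert t E) b = entry S E b := by
  refine entry_congr fun c _ hbc hcb => ?_
  have : c ≠ t := by
    rintro rfl
    exact hcb (h hbc)
  simp [this]

theorem entryPair_eq_of_boxProd_insert_eq {E : Set (ℕ × ℕ)} {p t : ℕ × ℕ} (hp : p ∈ S.boxes)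
    (ht : t ∈ S.boxes) (hpE : p ∉ E) (htE : t ∉ E)
    (h : boxProd S (insert t E) = boxProd S (insert p E)) :
    entryPair S E t = entryPair S E p := by
  rw [boxProd_insert (T := E) ht (fun _ _ _ _ => Iff.rfl) htE,
    boxProd_insert (T := E) hp (fun _ _ _ _ => Iff.rfl) hpE, mul_left_inj] at h
  have hneT := entry_ne (S := S) E t
  have h1 := congrArg (fun g => g (entry S E t (lab n k t))) h
  simp only [Equiv.swap_apply_left] at h1
  rw [entryPair, entryPair, pair_eq_pair_iff hneT]
  rw [Equiv.swap_apply_def] at h1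
  split_ifs at h1 with h2 h3
  · exact Or.inl ⟨h2, h1⟩
  · exact Or.inr ⟨h3, h1⟩
  · exact absurd h1.symm hneT

/-- If two pipes are inverted at all their meetings between `d` and `e`, then they do not cross
strictly between `d` and `e`. -/
theorem no_crossing_between {P : Finset ℕ} {d e : ℕ × ℕ} (he : e ∈ S.boxes)
    (heP : entryPair S T e = P) (hde : d ≠ e) (hin : inIn e d)
    (hinv : ∀ b ∈ S.boxes, inIn b d → b ≠ d → inIn e b → entryPair S T b = P →
      entry S T b (lab n k b + 1) < entry S T b (lab n k b)) :
    ∀ x ∈ S.boxes, x ∈ T → entryPair S T x = P → inIn e x → inIn x d → x = d ∨ x = e := by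
  by_contra! hcon
  obtain ⟨x₀, hx₀, hx₀T, hx₀P, hex₀, hx₀d, hx₀ne, hx₀ne'⟩ := hcon
  obtain ⟨x, hx, ⟨hxT, hxP, hex, hxd, hxne, hxne'⟩, hmin⟩ := exists_northwest_minimal (S := S)
    (F := {x | x ∈ T ∧ entryPair S T x = P ∧ inIn e x ∧ inIn x d ∧ x ≠ d ∧ x ≠ e})
    ⟨x₀, hx₀, hx₀T, hx₀P, hex₀, hx₀d, hx₀ne, hx₀ne'⟩
  have hswap := entry_swap_of_consecutive hx he hxT hxne' hex (hxP.trans heP.symm)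
    fun y hy hyT hyP hey hyx => by
      by_cases hye : y = e
      · exact Or.inr hye
      · refine Or.inl (hmin y hy ⟨hyT, hyP.trans hxP, hey, inIn_trans hyx hxd, ?_, hye⟩ hyx)
        rintro rfl
        exact hxne (inIn_antisymm hxd hyx)
  have h1 := hinv x hx hxd hxne hex hxP
  have h2 := hinv e he hin hde.symm ⟨le_rfl, le_rfl⟩ heP
  rw [hswap.1, hswap.2] at h2
  exact lt_asymm h1 h2

variable {E : Set (ℕ × ℕ)} {p t : ℕ × ℕ}

/-- A length-decreasing exchange in which the crossing moves northwest, away from the last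
crossing `t` of the two pipes before `p`. -/
theorem exchange_northwest (hp : p ∈ S.boxes) (ht : t ∈ S.boxes)
    (htE : t ∉ E) (hpt : p ≠ t) (hin : inIn p t) (hpair : entryPair S E t = entryPair S E p)
    (hle : ∀ b ∈ S.boxes, len n (entry S (insert p E) b) ≤ len n (entry S (insert t E) b)) :
    entryPair S (insert t E) t = entryPair S (insert t E) p ∧
    (∀ x ∈ S.boxes, x ∈ insert t E → entryPair S (insert t E) x = entryPair S (insert t E) t →
      inIn p x → inIn x t → x = t ∨ x = p) ∧
    entry S (insert t E) p (lab n k p + 1) < entry S (insert t E) p (lab n k p) := by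
  have htt : entry S (insert t E) t = entry S E t := entry_insert_of_not fun _ => rfl
  have hP : entryPair S (insert t E) t = entryPair S E t := by rw [entryPair, htt, entryPair]
  have hP' : entryPair S (insert t E) p = entryPair S E t := by
    have h := hpair
    rw [entryPair, entryPair, pair_eq_pair_iff (entry_ne E t)] at h
    rw [entryPair, entryPair, entry_insert ht htE hin hpt.symm, Equiv.Perm.mul_apply,
      Equiv.Perm.mul_apply]
    rcases h with ⟨h1, h2⟩ | ⟨h1, h2⟩ <;>
      simp [← h1, ← h2, Finset.pair_comm]
  have hinv : ∀ b ∈ S.boxes, inIn b t → b ≠ t → inIn p b →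
      entryPair S (insert t E) b = entryPair S E t →
      entry S (insert t E) b (lab n k b + 1) < entry S (insert t E) b (lab n k b) := by
    intro b hb hbt hne hpb hbP
    refine apply_succ_lt_of_len_swap_mul_le (lab_lt hb) hbP ?_
    refine le_trans (le_of_eq ?_) (hle b hb)
    rw [entry_insert ht htE hbt hne.symm, ← mul_assoc, Equiv.swap_mul_self, one_mul,
      entry_insert_of_not (t := p) fun hbp => inIn_antisymm hpb hbp]
  refine ⟨hP.trans hP'.symm, ?_, hinv p hp hin hpt ⟨le_rfl, le_rfl⟩ hP'⟩
  rw [hP]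
  exact no_crossing_between hp hP' hpt.symm hin hinv

/-- A length-decreasing exchange in which the crossing moves southeast, away from the first
uncrossing `t` of the two pipes after `p`. -/
theorem exchange_southeast (hp : p ∈ S.boxes) (ht : t ∈ S.boxes) (hpE : p ∉ E)
    (hpt : p ≠ t) (hin : inIn t p) (hpair : entryPair S E t = entryPair S E p)
    (hle : ∀ b ∈ S.boxes, len n (entry S (insert p E) b) ≤ len n (entry S (insert t E) b)) :
    entryPair S (insert t E) t = entryPair S (insert t E) p ∧
    (∀ x ∈ S.boxes, x ∈ insert t E → entryPair S (insert t E) x = entryPair S (insert t E) t →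
      inIn t x → inIn x p → x = p ∨ x = t) ∧
    entry S (insert t E) t (lab n k t + 1) < entry S (insert t E) t (lab n k t) := by
  have hsame : ∀ b, inIn t b → entry S (insert t E) b = entry S E b := fun b htb =>
    entry_insert_of_not fun hbt => inIn_antisymm htb hbt
  have hP : entryPair S (insert t E) t = entryPair S E p := by
    rw [← hpair, entryPair, hsame t ⟨le_rfl, le_rfl⟩, entryPair]
  have hP' : entryPair S (insert t E) p = entryPair S E p := by
    rw [entryPair, hsame p hin, entryPair]
  have hinv : ∀ b ∈ S.boxes, inIn b p → b ≠ p → inIn t b →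
      entryPair S (insert t E) b = entryPair S E p →
      entry S (insert t E) b (lab n k b + 1) < entry S (insert t E) b (lab n k b) := by
    intro b hb hbp hne htb hbP
    refine apply_succ_lt_of_len_swap_mul_le (lab_lt hb) hbP ?_
    refine le_trans (le_of_eq ?_) (hle b hb)
    rw [entry_insert hp hpE hbp hne.symm, hsame b htb]
  refine ⟨hP.trans hP'.symm, ?_, hinv t ht hin hpt.symm ⟨le_rfl, le_rfl⟩ hP⟩
  rw [hP]
  exact no_crossing_between ht hP hpt hin hinv

/-- Two pipes that are inverted at the crossing `t` and do not cross between `p` and `t` have a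
last crossing `w` before `p`. -/
theorem exists_last_crossing (hp : p ∈ S.boxes) (ht : t ∈ S.boxes) (hpT : p ∉ T)
    (hpt : p ≠ t) (hin : inIn t p) (hpair : entryPair S T t = entryPair S T p)
    (hno : ∀ x ∈ S.boxes, x ∈ T → entryPair S T x = entryPair S T t → inIn t x → inIn x p →
      x = p ∨ x = t)
    (hinv : entry S T t (lab n k t + 1) < entry S T t (lab n k t)) :
    ∃ w ∈ S.boxes, w ∈ T ∧ w ≠ t ∧ inIn p w ∧ entryPair S T w = entryPair S T t ∧
      ∀ x ∈ S.boxes, x ∈ T → entryPair S T x = entryPair S T w → inIn t x → inIn x w →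
        x = w ∨ x = t := by
  have hex : ∃ x ∈ S.boxes,
      x ∈ {x | x ∈ T ∧ entryPair S T x = entryPair S T t ∧ inIn t x ∧ x ≠ t} := by
    by_contra! hcon
    refine lt_asymm hinv (entry_lt_of_no_crossing ht fun x hx hxT hxP htx => ?_)
    by_contra hxt
    exact hcon x hx ⟨hxT, hxP, htx, hxt⟩
  obtain ⟨w, hw, ⟨hwT, hwP, htw, hwt⟩, hmin⟩ := exists_northwest_minimal hex
  refine ⟨w, hw, hwT, hwt, ?_, hwP, fun x hx hxT hxP htx hxw => ?_⟩
  · refine (comparable_of_entryPair_eq hp hw (hpair.symm.trans hwP.symm)).resolve_right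
      fun hwp => ?_
    rcases hno w hw hwT hwP htw hwp with rfl | rfl
    · exact hpT hwT
    · exact hwt rfl
  · by_cases hxt : x = t
    · exact Or.inr hxt
    · exact Or.inl (hmin x hx ⟨hxT, hxP.trans hwP, htx, hxt⟩ hxw)

end Exchange

section Flips

variable {n k : ℕ} {D : Diagram n k} {p t w : ℕ × ℕ}

theorem pipePair_setFill {f : Fill} {b : ℕ × ℕ} (hb : b ∈ D.S.boxes) (hpb : inIn p b) :
    pipeB (setFill D p f) b = pipeB D b ∧ pipeR (setFill D p f) b = pipeR D b := by
  refine pipe_congr (D := setFill D p f) hb rfl fun c _ hbc hcb => ?_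
  have : c ≠ p := by
    rintro rfl
    exact hcb (inIn_antisymm hpb hbc)
  simp [setFill, this]

theorem crossUncrossPair_of_consecutive {b c : ℕ × ℕ} (hb : IsStone D b) (hc : IsStone D c)
    (hbc : b ≠ c) (hin : inIn c b) (hinv : pipeB D c < pipeR D c)
    (hpair : pipePair D b = pipePair D c)
    (hno : ∀ x ∈ D.S.boxes, x ∈ stones D →
      entryPair D.S (stones D) x = entryPair D.S (stones D) b → inIn c x → inIn x b →
        x = b ∨ x = c) :
    CrossUncrossPair D b c := by
  rw [pipePair_eq_entryPair hb.1, pipePair_eq_entryPair hc.1] at hpair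
  have hswap := entry_swap_of_consecutive hb.1 hc.1 hb.2 hbc hin hpair hno
  refine ⟨hb, hc, hbc, ?_, hinv, ?_, hin, fun x hx hxP hcx hxb => ?_⟩
  · rw [pipeB_eq_entry hb.1, pipeR_eq_entry hb.1, ← hswap.1, ← hswap.2, ← pipeB_eq_entry hc.1,
      ← pipeR_eq_entry hc.1]
    exact hinv
  · rw [pipePair_eq_entryPair hb.1, pipePair_eq_entryPair hc.1, hpair]
  · rw [pipePair_eq_entryPair hb.1, pipePair_eq_entryPair hx.1] at hxP
    exact hno x hx.1 hx.2 hxP hcx hxb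

/-- Placing a stone at `p` creates a crossing/uncrossing pair `(w, p)` if `w` is the last
crossing before `p` of the two pipes through `p`. -/
theorem crossUncrossPair_setFill (hp : p ∈ D.S.boxes) (hw : IsStone D w)
    (hpw : inIn p w) (hne : w ≠ p) (hpair : entryPair D.S (stones D) w = entryPair D.S (stones D) p)
    (hno : ∀ x ∈ D.S.boxes, x ∈ stones D →
      entryPair D.S (stones D) x = entryPair D.S (stones D) w → inIn p x → inIn x w →
        x = w ∨ x = p)
    (hinv : pipeB D p < pipeR D p) : CrossUncrossPair (setFill D p Fill.white) w p := by
  have hpipe := fun b (hb : b ∈ D.S.boxes) (hpb : inIn p b) =>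
    pipePair_setFill (f := Fill.white) hb hpb
  have hpp := hpipe p hp ⟨le_rfl, le_rfl⟩
  have hpairs : ∀ b ∈ D.S.boxes, inIn p b →
      entryPair D.S (stones (setFill D p Fill.white)) b = entryPair D.S (stones D) b := by
    intro b hb hpb
    rw [← pipePair_eq_entryPair hb, pipePair, ← (hpipe b hb hpb).1, ← (hpipe b hb hpb).2,
      ← pipePair]
    exact (pipePair_eq_entryPair (D := setFill D p Fill.white) hb).symm
  have hpself : inIn p p := ⟨le_rfl, le_rfl⟩
  refine crossUncrossPair_of_consecutive (D := setFill D p Fill.white) ⟨hw.1, ?_⟩ ⟨hp, ?_⟩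
    hne hpw ?_ ?_ fun x hx hxT hxP hpx hxw => ?_
  · simpa [setFill, hne] using hw.2
  · simp [setFill]
  · rw [hpp.1, hpp.2]
    exact hinv
  · rw [pipePair_eq_entryPair (D := setFill D p Fill.white) hw.1,
      pipePair_eq_entryPair (D := setFill D p Fill.white) hp]
    exact (hpairs w hw.1 hpw).trans (hpair.trans (hpairs p hp hpself).symm)
  · by_cases hxp : x = p
    · exact Or.inr hxp
    · refine hno x hx ?_ ((hpairs x hx hpx).symm.trans (hxP.trans (hpairs w hw.1 hpw))) hpx hxw
      simpa [stones, setFill, hxp] using hxT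

theorem dEq_flipPlusWith {D' : Diagram n k} (hS : D.S = D'.S) (hBD' : BlackIffUncross D')
    (hpD' : D'.fill p ≠ Fill.plus) (htD' : D'.fill t = Fill.plus)
    (hrest : ∀ b : ℕ × ℕ, b ≠ p → b ≠ t → (D.fill b = Fill.plus ↔ D'.fill b = Fill.plus)) :
    DEq D' (flipPlusWith D p t) := by
  have hplus : ∀ b, (setFill (setFill D p Fill.white) t Fill.plus).fill b = Fill.plus ↔
      D'.fill b = Fill.plus := by
    intro b
    by_cases hbt : b = t
    · subst hbt; simp [setFill, htD']
    · by_cases hbp : b = p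
      · subst hbp; simp [setFill, hbt, hpD']
      · simpa [setFill, hbt, hbp] using hrest b hbp hbt
  refine ⟨hS.symm, fun b hb => ?_⟩
  have hpipe := pipe_congr (D := D') (D' := setFill (setFill D p Fill.white) t Fill.plus) hb
    hS.symm fun c _ _ _ => (hplus c).symm
  have hblack := hBD' b hb
  rw [hpipe.1, hpipe.2] at hblack
  simp only [flipPlusWith, recolor, hplus]
  split_ifs with h1 h2
  · exact h1
  · exact hblack.2 ⟨h1, h2⟩
  · cases hf : D'.fill b with
    | black => exact absurd (hblack.1 hf).2 h2
    | white => rfl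
    | plus => exact absurd hf h1

end Flips

/-- If `D` and `D'` have the same pair of permutations, `D'` is
obtained from `D` by exchanging a single elbow tile and a single crossing tile,
and `u_{b^in}^{D} ≥ u_{b^in}^{D'}` in Bruhat order for every box, then `D'` is
obtained from `D` by a corrective flip. -/
theorem single_exchange_decreasing_is_corrective_flip {n k : ℕ}
    (D D' : Diagram n k) (hS : D.S = D'.S)
    (hBD : BlackIffUncross D) (hBD' : BlackIffUncross D')
    (hu : permU D = permU D')
    (p t : ℕ × ℕ) (hpt : p ≠ t) (hp : p ∈ D.S.boxes) (ht : t ∈ D.S.boxes)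
    (hpD : D.fill p = Fill.plus) (htD : D.fill t ≠ Fill.plus)
    (hpD' : D'.fill p ≠ Fill.plus) (htD' : D'.fill t = Fill.plus)
    (hrest : ∀ b : ℕ × ℕ, b ≠ p → b ≠ t → (D.fill b = Fill.plus ↔ D'.fill b = Fill.plus))
    (hle : ∀ b ∈ D.S.boxes, BruhatLE n (uIn D' b) (uIn D b)) :
    IsCorrectiveFlip D D' := by
  have hpE : p ∉ stones D \ {t} := fun h => h.1 hpD
  have htE : t ∉ stones D \ {t} := fun h => h.2 rfl
  have hT : stones D = insert t (stones D \ {t}) := by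
    ext b
    by_cases hb : b = t
    · subst hb; simpa [stones] using htD
    · simp [hb]
  have hT' : stones D' = insert p (stones D \ {t}) := by
    ext b
    by_cases hbp : b = p
    · subst hbp; simpa [stones] using hpD'
    · by_cases hbt : b = t
      · subst hbt; simpa [stones, hbp] using htD'
      · simpa [stones, hbp, hbt] using not_congr (hrest b hbp hbt).symm
  have hpair : entryPair D.S (stones D \ {t}) t = entryPair D.S (stones D \ {t}) p := by
    refine entryPair_eq_of_boxProd_insert_eq hp ht hpE htE ?_
    rw [← hT, ← hT', ← permU_eq_boxProd, hu, permU_eq_boxProd, hS]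
  have hlen : ∀ b ∈ D.S.boxes, len n (entry D.S (insert p (stones D \ {t})) b) ≤
      len n (entry D.S (insert t (stones D \ {t})) b) := by
    intro b hb
    rw [← hT, ← hT', ← uIn_eq_entry, hS, ← uIn_eq_entry]
    exact (hle b hb).len_le
  have hpT : p ∉ stones D := fun h => h hpD
  refine ⟨p, t, ?_, dEq_flipPlusWith hS hBD' hpD' htD' hrest⟩
  rcases comparable_of_entryPair_eq ht hp hpair with hin | hin
  · obtain ⟨hP, hno, hinv⟩ := exchange_southeast hp ht hpE hpt hin hpair hlen
    rw [← hT] at hP hno hinv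
    obtain ⟨w, hw, hwT, hwt, hpw, hwP, hw_no⟩ :=
      exists_last_crossing hp ht hpT hpt hin hP hno hinv
    have hwp : w ≠ p := by rintro rfl; exact hpT hwT
    have hpno : ∀ x ∈ D.S.boxes, x ∈ stones D →
        entryPair D.S (stones D) x = entryPair D.S (stones D) w → inIn p x → inIn x w →
          x = w ∨ x = p := by
      intro x hx hxT hxP hpx hxw
      refine (hw_no x hx hxT hxP (inIn_trans hin hpx) hxw).imp_right ?_
      rintro rfl
      exact inIn_antisymm hin hpx
    have h1 := entry_swap_of_consecutive hw ht hwT hwt (inIn_trans hin hpw) hwP hw_no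
    have h2 := entry_swap_of_consecutive hw hp hwT hwp hpw (hwP.trans hP) hpno
    have hinv_p : pipeB D p < pipeR D p := by
      rw [pipeB_eq_entry hp, pipeR_eq_entry hp, h2.1, h2.2, ← h1.1, ← h1.2]
      exact hinv
    refine ⟨hp, hpD, lenDrop_of_pipeB_lt hp hpD hinv_p, w,
      crossUncrossPair_setFill hp ⟨hw, hwT⟩ hpw hwp (hwP.trans hP) hpno hinv_p, Or.inr ?_⟩
    refine crossUncrossPair_of_consecutive ⟨hw, hwT⟩ ⟨ht, htD⟩ hwt (inIn_trans hin hpw) ?_ ?_ hw_no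
    · rw [pipeB_eq_entry ht, pipeR_eq_entry ht]
      exact hinv
    · rw [pipePair_eq_entryPair hw, pipePair_eq_entryPair ht, hwP]
  · obtain ⟨hP, hno, hinv⟩ := exchange_northwest hp ht htE hpt hin hpair hlen
    rw [← hT] at hP hno hinv
    have hinv_p : pipeB D p < pipeR D p := by
      rw [pipeB_eq_entry hp, pipeR_eq_entry hp]
      exact hinv
    exact ⟨hp, hpD, lenDrop_of_pipeB_lt hp hpD hinv_p, t,
      crossUncrossPair_setFill hp ⟨ht, htD⟩ hin hpt.symm hP hno hinv_p, Or.inl rfl⟩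

end GoPaper
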